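/- arXiv:1312.2037 — 2 statements merged into one kernel-verified Lean document; each statement's English description precedes it below -/
import Mathlib

section
/- Let φ(z) = ∫_0^∞ z^a / Γ(a) da for z > 0 (the Fransén–Wrigge function) and ν(z) = ∫_0^∞ z^x / Γ(x+1) dx. Then for all c > 0 and u > 0, ∫_0^u φ(c·t)/t dt = ν(c·u). -/
open MeasureTheory intervalIntegral

/-- The Fransén–Wrigge function `φ(z) = ∫_0^∞ z^a / Γ(a) da`. -/
noncomputable def fransenWrigge (z : ℝ) : ℝ :=
  ∫ a in Set.Ioi (0:ℝ), z ^ a / Real.Gamma a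

/-- The Volterra ν-function `ν(z) = ∫_0^∞ z^x / Γ(x+1) dx`. -/
noncomputable def volterraNu (z : ℝ) : ℝ :=
  ∫ x in Set.Ioi (0:ℝ), z ^ x / Real.Gamma (x + 1)

theorem rpow_mul_exp_neg_le_Gamma_add_one {T x : ℝ} (hT : 0 < T) (hx : 0 ≤ x) :
    T ^ x * Real.exp (-T) ≤ Real.Gamma (x + 1) := by
  have hint : IntegrableOn (fun t : ℝ => Real.exp (-t) * t ^ x) (Set.Ioi 0) := by
    simpa using Real.GammaIntegral_convergent (by linarith : 0 < x + 1)
  have hsub : Set.Ioi T ⊆ Set.Ioi (0 : ℝ) := Set.Ioi_subset_Ioi hT.le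
  calc T ^ x * Real.exp (-T) = ∫ t in Set.Ioi T, T ^ x * Real.exp (-t) := by
        rw [MeasureTheory.integral_const_mul, integral_exp_neg_Ioi]
    _ ≤ ∫ t in Set.Ioi T, Real.exp (-t) * t ^ x := by
        refine setIntegral_mono_on ((integrableOn_exp_neg_Ioi T).const_mul _)
          (hint.mono_set hsub) measurableSet_Ioi fun t ht => ?_
        rw [mul_comm]
        gcongr
        exact le_of_lt ht
    _ ≤ ∫ t in Set.Ioi (0 : ℝ), Real.exp (-t) * t ^ x := by
        refine setIntegral_mono_set hint ?_ hsub.eventuallyLE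
        filter_upwards [ae_restrict_mem measurableSet_Ioi] with t ht
        have : (0 : ℝ) < t := ht
        simp only [Pi.zero_apply]
        positivity
    _ = Real.Gamma (x + 1) := by
        rw [Real.Gamma_eq_integral (by linarith)]
        simp

theorem continuousOn_Gamma_Ioi : ContinuousOn Real.Gamma (Set.Ioi 0) := fun x hx =>
  (Real.differentiableAt_Gamma fun m => by
    have : (0 : ℝ) < x := hx
    have : (0 : ℝ) ≤ m := m.cast_nonneg
    linarith).continuousAt.continuousWithinAt

theorem integrableOn_rpow_div_Gamma_add_one {z : ℝ} (hz : 0 < z) :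
    IntegrableOn (fun x : ℝ => z ^ x / Real.Gamma (x + 1)) (Set.Ioi 0) := by
  set T := Real.exp 1 * z with hT
  have hTpos : 0 < T := by positivity
  refine Integrable.mono' ((integrableOn_exp_neg_Ioi 0).const_mul (Real.exp T)) ?_ ?_
  · refine ContinuousOn.aestronglyMeasurable ?_ measurableSet_Ioi
    refine ContinuousOn.div (Real.continuous_const_rpow hz.ne').continuousOn
      (continuousOn_Gamma_Ioi.comp (by fun_prop) fun x hx => ?_) fun x hx => ?_
    · have : (0 : ℝ) < x := hx
      exact Set.mem_Ioi.2 (by linarith)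
    · have : (0 : ℝ) < x := hx
      exact (Real.Gamma_pos_of_pos (by linarith)).ne'
  · filter_upwards [ae_restrict_mem measurableSet_Ioi] with x hx
    have hx : (0 : ℝ) < x := hx
    have hΓ : 0 < Real.Gamma (x + 1) := Real.Gamma_pos_of_pos (by linarith)
    rw [Real.norm_of_nonneg (by positivity), div_le_iff₀ hΓ]
    calc z ^ x = Real.exp T * Real.exp (-x) * (T ^ x * Real.exp (-T)) := by
          rw [hT, Real.mul_rpow (Real.exp_pos 1).le hz.le, Real.exp_one_rpow, ← hT,
            Real.exp_neg, Real.exp_neg]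
          field_simp
      _ ≤ _ := by
          gcongr
          exact rpow_mul_exp_neg_le_Gamma_add_one hTpos hx.le

theorem fransenWrigge_integrand_eq {a c t : ℝ} (hc : 0 < c) (ht : 0 < t) :
    (c * t) ^ a / Real.Gamma a / t = c ^ a / Real.Gamma a * t ^ (a - 1) := by
  rw [Real.mul_rpow hc.le ht.le, Real.rpow_sub_one ht.ne']
  ring

theorem integrableOn_fransenWrigge_integrand {a c u : ℝ} (hc : 0 < c) (hu : 0 < u) (ha : 0 < a) :
    IntegrableOn (fun t : ℝ => (c * t) ^ a / Real.Gamma a / t) (Set.Ioc 0 u) := by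
  have h := (intervalIntegrable_rpow' (a := 0) (b := u)
    (by linarith : -1 < a - 1)).const_mul (c ^ a / Real.Gamma a)
  rw [intervalIntegrable_iff_integrableOn_Ioc_of_le hu.le] at h
  exact h.congr_fun (fun t ht => (fransenWrigge_integrand_eq hc ht.1).symm) measurableSet_Ioc

theorem integral_fransenWrigge_integrand {a c u : ℝ} (hc : 0 < c) (hu : 0 < u) (ha : 0 < a) :
    ∫ t in Set.Ioc 0 u, (c * t) ^ a / Real.Gamma a / t = (c * u) ^ a / Real.Gamma (a + 1) := by
  rw [setIntegral_congr_fun measurableSet_Ioc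
      fun t ht => fransenWrigge_integrand_eq (a := a) hc ht.1,
    ← integral_of_le hu.le, intervalIntegral.integral_const_mul,
    integral_rpow (Or.inl (by linarith)), sub_add_cancel, Real.zero_rpow ha.ne',
    Real.Gamma_add_one ha.ne', Real.mul_rpow hc.le hu.le]
  have := Real.Gamma_pos_of_pos ha
  field_simp
  ring

theorem integrable_prod_fransenWrigge_integrand {c u : ℝ} (hc : 0 < c) (hu : 0 < u) :
    Integrable (fun p : ℝ × ℝ => (c * p.1) ^ p.2 / Real.Gamma p.2 / p.1)
      ((volume.restrict (Set.Ioc 0 u)).prod (volume.restrict (Set.Ioi 0))) := by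
  have hmeas : AEStronglyMeasurable
      (fun p : ℝ × ℝ => (c * p.1) ^ p.2 / Real.Gamma p.2 / p.1)
      ((volume.restrict (Set.Ioc 0 u)).prod (volume.restrict (Set.Ioi 0))) := by
    rw [Measure.prod_restrict]
    refine ContinuousOn.aestronglyMeasurable ?_ (measurableSet_Ioc.prod measurableSet_Ioi)
    refine ((ContinuousOn.rpow (by fun_prop) (by fun_prop) fun p hp =>
      Or.inl (mul_pos hc hp.1.1).ne').div
        (continuousOn_Gamma_Ioi.comp (by fun_prop) fun p hp => hp.2) fun p hp =>
          (Real.Gamma_pos_of_pos hp.2).ne').div (by fun_prop) fun p hp => hp.1.1.ne'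
  refine (integrable_prod_iff' hmeas).2 ⟨?_, ?_⟩
  · filter_upwards [ae_restrict_mem measurableSet_Ioi] with a ha
    exact integrableOn_fransenWrigge_integrand hc hu ha
  · refine (integrableOn_rpow_div_Gamma_add_one (mul_pos hc hu)).congr_fun
      (fun a ha => ?_) measurableSet_Ioi
    refine (integral_fransenWrigge_integrand hc hu ha).symm.trans ?_
    refine setIntegral_congr_fun measurableSet_Ioc fun t ht => ?_
    have h1 : 0 < t := ht.1
    have h2 := Real.Gamma_pos_of_pos ha
    exact (Real.norm_of_nonneg (by positivity)).symm

/-- For all `c > 0` and `u > 0`, `∫_0^u φ(c t)/t dt = ν(c u)`. -/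
theorem stmt_7 (c u : ℝ) (hc : 0 < c) (hu : 0 < u) :
    ∫ t in (0:ℝ)..u, fransenWrigge (c * t) / t = volterraNu (c * u) := by
  rw [integral_of_le hu.le]
  simp only [fransenWrigge, volterraNu, ← MeasureTheory.integral_div]
  rw [integral_integral_swap (integrable_prod_fransenWrigge_integrand hc hu)]
  exact setIntegral_congr_fun measurableSet_Ioi fun a ha =>
    integral_fransenWrigge_integrand hc hu ha
end

section
/- Let ν(z) = ∫_0^∞ z^x / Γ(x+1) dx for z > 0. Then lim sup and lim inf agree and lim_{z → 0+} (−ln z) · ν(z) = 1; equivalently ν(z) ~ −1/ln z as z → 0+. -/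
open MeasureTheory Filter

theorem differentiableAt_Gamma_of_pos {x : ℝ} (hx : 0 < x) :
    DifferentiableAt ℝ Real.Gamma x :=
  Real.differentiableAt_Gamma fun n => by
    have : (0 : ℝ) ≤ n := n.cast_nonneg
    linarith

/-- The Gamma function is bounded below by a positive constant on the positive half-line. -/
theorem exists_pos_forall_le_Gamma : ∃ m : ℝ, 0 < m ∧ ∀ x : ℝ, 0 < x → m ≤ Real.Gamma x := by
  obtain ⟨x₀, hx₀, hmin⟩ := Real.exists_isMinOn_Gamma_Ioi
  exact ⟨Real.Gamma x₀, Real.Gamma_pos_of_pos (by linarith [hx₀.1]), fun x hx => hmin hx⟩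

theorem neg_log_mul_volterraNu {z : ℝ} (hz : 0 < z) (hlog : Real.log z < 0) :
    (-Real.log z) * volterraNu z =
      ∫ u in Set.Ioi (0 : ℝ), Real.exp (-u) / Real.Gamma (u / (-Real.log z) + 1) := by
  have h := integral_comp_mul_left_Ioi'
    (fun u : ℝ => Real.exp (-u) / Real.Gamma (u / (-Real.log z) + 1)) 0 (neg_pos.mpr hlog)
  rw [mul_zero, smul_eq_mul] at h
  rw [← h, volterraNu]
  congr 1
  refine integral_congr_ae (Eventually.of_forall fun x => ?_)
  simp only
  rw [mul_div_cancel_left₀ _ (neg_ne_zero.mpr hlog.ne), Real.rpow_def_of_pos hz, neg_mul, neg_neg]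

theorem tendsto_integral_exp_neg_div_Gamma :
    Tendsto (fun L : ℝ => ∫ u in Set.Ioi (0 : ℝ), Real.exp (-u) / Real.Gamma (u / L + 1))
      atTop (nhds 1) := by
  obtain ⟨m, hm, hle⟩ := exists_pos_forall_le_Gamma
  rw [show nhds (1 : ℝ) = nhds (∫ u in Set.Ioi (0 : ℝ), Real.exp (-u)) by
    rw [integral_exp_neg_Ioi_zero]]
  refine tendsto_integral_filter_of_dominated_convergence (fun u => Real.exp (-u) / m) ?_ ?_
    ((integrableOn_exp_neg_Ioi 0).div_const m) ?_
  · filter_upwards [eventually_gt_atTop 0] with L hL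
    refine ContinuousOn.aestronglyMeasurable (fun u hu => ?_) measurableSet_Ioi
    have hpos : 0 < u / L + 1 := add_pos (div_pos hu hL) one_pos
    have hΓ : ContinuousAt Real.Gamma (u / L + 1) :=
      (differentiableAt_Gamma_of_pos hpos).continuousAt
    have hcomp : ContinuousAt (fun v : ℝ => Real.Gamma (v / L + 1)) u :=
      ContinuousAt.comp (f := fun v : ℝ => v / L + 1) hΓ (by fun_prop)
    have hexp : ContinuousAt (fun v : ℝ => Real.exp (-v)) u := by fun_prop
    exact (hexp.div hcomp
      (Real.Gamma_pos_of_pos hpos).ne').continuousWithinAt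
  · filter_upwards [eventually_gt_atTop 0] with L hL
    filter_upwards [ae_restrict_mem measurableSet_Ioi] with u hu
    have hpos : 0 < u / L + 1 := add_pos (div_pos hu hL) one_pos
    rw [Real.norm_of_nonneg (div_nonneg (Real.exp_pos _).le (Real.Gamma_pos_of_pos hpos).le)]
    exact div_le_div_of_nonneg_left (Real.exp_pos _).le hm (hle _ hpos)
  · refine Eventually.of_forall fun u => ?_
    have hu : Tendsto (fun L : ℝ => u / L + 1) atTop (nhds 1) := by
      simpa using (tendsto_const_nhds.div_atTop tendsto_id).add_const (1 : ℝ)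
    have hΓ := (differentiableAt_Gamma_of_pos one_pos).continuousAt.tendsto.comp hu
    rw [Real.Gamma_one] at hΓ
    have hdiv : Tendsto (fun L : ℝ => Real.exp (-u) / Real.Gamma (u / L + 1)) atTop
        (nhds (Real.exp (-u) / 1)) := tendsto_const_nhds.div hΓ one_ne_zero
    rwa [div_one] at hdiv

/-- `ν(z) ~ -1/log z` as `z → 0+`: `(-log z) · ν(z) → 1` as `z → 0+`. -/
theorem stmt_13 :
    Tendsto (fun z : ℝ => (-Real.log z) * volterraNu z)
      (nhdsWithin 0 (Set.Ioi 0)) (nhds 1) := by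
  have hlog : Tendsto (fun z : ℝ => -Real.log z) (nhdsWithin 0 (Set.Ioi 0)) atTop :=
    tendsto_neg_atBot_atTop.comp Real.tendsto_log_nhdsGT_zero
  refine (tendsto_integral_exp_neg_div_Gamma.comp hlog).congr' ?_
  filter_upwards [Ioo_mem_nhdsGT one_pos] with z hz
  exact (neg_log_mul_volterraNu hz.1 (Real.log_neg hz.1 hz.2)).symm
end
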